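/- In a proper unital *-ring A with A_Σ salient, the orthogonality relation a ⊥ b ⟺ ab = 0 is symmetric on 𝔠 ∪ A_n: if a, b each lie in 𝔠 or are normal, then ab = 0 if and only if ba = 0. -/

import Mathlib

open Pointwise

/-- Finite sums of elements of the form `star a * a`. -/
def sSums (A : Type*) [Ring A] [StarRing A] : Set A :=
  (AddSubmonoid.closure {x : A | ∃ a : A, x = star a * a} : Set A)

/-- The *-positive elements. -/
def pos (A : Type*) [Ring A] [StarRing A] : Set A :=
  {a : A | ∃ n : ℕ, 0 < n ∧ n • a ∈ sSums A}

/-- The *-accretive elements. -/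
def accr (A : Type*) [Ring A] [StarRing A] : Set A :=
  {a : A | a + star a ∈ pos A}

/-- The order `a ⪯ b ⟺ b - a ∈ 𝔯`. -/
def ple {A : Type*} [Ring A] [StarRing A] (a b : A) : Prop := b - a ∈ accr A

/-- The cone `𝔠`. -/
def cone (A : Type*) [Ring A] [StarRing A] : Set A :=
  {a : A | ∃ n : ℕ, 0 < n ∧ ple (star a * a) (n • a)}

/-- The ball `𝔅`. -/
def ball (A : Type*) [Ring A] [StarRing A] : Set A :=
  {a : A | ple (star a * a) 1}

section Helpers

variable {A : Type*} [Ring A] [StarRing A]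

theorem star_mul_self_mem_sSums (a : A) : star a * a ∈ sSums A :=
  AddSubmonoid.subset_closure ⟨a, rfl⟩

theorem add_mem_sSums {x y : A} (hx : x ∈ sSums A) (hy : y ∈ sSums A) : x + y ∈ sSums A :=
  AddSubmonoid.add_mem _ hx hy

theorem nsmul_mem_sSums {x : A} (hx : x ∈ sSums A) (n : ℕ) : n • x ∈ sSums A :=
  AddSubmonoid.nsmul_mem _ hx n

theorem conj_mem_sSums {s : A} (hs : s ∈ sSums A) (b : A) : star b * s * b ∈ sSums A := by
  induction hs using AddSubmonoid.closure_induction with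
  | mem x hx =>
    obtain ⟨a, rfl⟩ := hx
    simpa [mul_assoc] using star_mul_self_mem_sSums (a * b)
  | zero => simpa using star_mul_self_mem_sSums (0 : A)
  | add x y _ _ hx hy => simpa [mul_add, add_mul] using add_mem_sSums hx hy

theorem eq_zero_of_add_eq_zero_of_mem_sSums (salient : sSums A ∩ (-sSums A) = {0}) {x y : A}
    (hx : x ∈ sSums A) (hy : y ∈ sSums A) (h : x + y = 0) : x = 0 := by
  have : x ∈ sSums A ∩ (-sSums A) := ⟨hx, by rwa [Set.mem_neg, neg_eq_of_add_eq_zero_right h]⟩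
  simpa [salient] using this

theorem mul_eq_zero_of_conj_eq_zero (proper : ∀ a : A, star a * a = 0 → a = 0)
    (salient : sSums A ∩ (-sSums A) = {0}) {s : A} (hs : s ∈ sSums A) (b : A)
    (h : star b * s * b = 0) : s * b = 0 := by
  induction hs using AddSubmonoid.closure_induction with
  | mem x hx =>
    obtain ⟨a, rfl⟩ := hx
    have : a * b = 0 := proper _ (by simpa [mul_assoc] using h)
    rw [mul_assoc, this, mul_zero]
  | zero => simp
  | add x y hx hy ihx ihy =>
    rw [mul_add, add_mul] at h
    have hx' := conj_mem_sSums hx b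
    have hy' := conj_mem_sSums hy b
    rw [add_mul, ihx (eq_zero_of_add_eq_zero_of_mem_sSums salient hx' hy' h),
      ihy (eq_zero_of_add_eq_zero_of_mem_sSums salient hy' hx' (by rwa [add_comm])), add_zero]

theorem eq_zero_of_nsmul_mem_sSums_eq_zero (salient : sSums A ∩ (-sSums A) = {0}) {x : A}
    (hx : x ∈ sSums A) {n : ℕ} (hn : 0 < n) (h : n • x = 0) : x = 0 := by
  obtain ⟨k, rfl⟩ := Nat.exists_eq_add_of_lt hn
  refine eq_zero_of_add_eq_zero_of_mem_sSums salient hx (nsmul_mem_sSums hx k) ?_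
  rw [← h, zero_add, succ_nsmul, add_comm]

theorem eq_zero_of_nsmul_eq_zero_of_salient (proper : ∀ a : A, star a * a = 0 → a = 0)
    (salient : sSums A ∩ (-sSums A) = {0}) {x : A} {n : ℕ} (hn : 0 < n) (h : n • x = 0) :
    x = 0 :=
  proper x <| eq_zero_of_nsmul_mem_sSums_eq_zero salient (star_mul_self_mem_sSums x) hn <| by
    rw [← mul_smul_comm, h, mul_zero]

theorem mul_eq_zero_iff_star_mul_eq_zero_of_mem_cone
    (proper : ∀ a : A, star a * a = 0 → a = 0) (salient : sSums A ∩ (-sSums A) = {0})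
    {a : A} (ha : a ∈ cone A) (b : A) : a * b = 0 ↔ star a * b = 0 := by
  obtain ⟨n, hn, m, hm, hs⟩ := ha
  have key : m • (n • a - star a * a + star (n • a - star a * a)) =
      (m * n) • (a + star a) - (m * 2) • (star a * a) := by
    simp only [star_sub, star_nsmul, star_mul, star_star, mul_smul, two_nsmul, smul_add, smul_sub]
    abel
  rw [key] at hs
  constructor <;> intro h
  · have h' : star b * star a = 0 := by rw [← star_mul, h, star_zero]
    have := mul_eq_zero_of_conj_eq_zero proper salient hs b (by
      simp only [mul_sub, sub_mul, mul_add, add_mul, mul_smul_comm, smul_mul_assoc, mul_assoc, h,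
        mul_zero, smul_zero, zero_add, sub_zero]
      rw [← mul_assoc, h', zero_mul, smul_zero])
    refine eq_zero_of_nsmul_eq_zero_of_salient proper salient (Nat.mul_pos hm hn) ?_
    simpa only [sub_mul, add_mul, smul_mul_assoc, mul_assoc, h, mul_zero, smul_zero, zero_add,
      sub_zero] using this
  · have h' : star b * a = 0 := by simpa using congrArg star h
    have hc := conj_mem_sSums hs b
    have hc' : star b * ((m * n) • (a + star a) - (m * 2) • (star a * a)) * b =
        -((m * 2) • (star (a * b) * (a * b))) := by
      simp only [mul_sub, sub_mul, mul_add, add_mul, mul_smul_comm, smul_mul_assoc, h', star_mul,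
        mul_assoc, h, mul_zero, zero_mul, smul_zero, add_zero, zero_sub]
    rw [hc'] at hc
    have hp := star_mul_self_mem_sSums (a * b)
    exact proper _ <| eq_zero_of_nsmul_mem_sSums_eq_zero salient hp (Nat.mul_pos hm two_pos) <|
      eq_zero_of_add_eq_zero_of_mem_sSums salient (nsmul_mem_sSums hp _) hc (add_neg_cancel _)

theorem mul_eq_zero_iff_star_mul_eq_zero_of_normal
    (proper : ∀ a : A, star a * a = 0 → a = 0) {a : A} (ha : a * star a = star a * a) (b : A) :
    a * b = 0 ↔ star a * b = 0 := by
  have key : star (a * b) * (a * b) = star (star a * b) * (star a * b) := by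
    simp only [star_mul, star_star, mul_assoc]
    rw [← mul_assoc (star a), ← ha, mul_assoc]
  constructor <;> intro h
  · exact proper _ (by rw [← key, h, mul_zero])
  · exact proper _ (by rw [key, h, mul_zero])

end Helpers

theorem stmt11 {A : Type*} [Ring A] [StarRing A]
    (proper : ∀ a : A, star a * a = 0 → a = 0)
    (salient : sSums A ∩ (-sSums A) = {0})
    (a b : A) (ha : a ∈ cone A ∪ {x : A | x * star x = star x * x})
    (hb : b ∈ cone A ∪ {x : A | x * star x = star x * x}) :
    a * b = 0 ↔ b * a = 0 := by
  have star_iff : ∀ c ∈ cone A ∪ {x : A | x * star x = star x * x}, ∀ d : A,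
      c * d = 0 ↔ star c * d = 0 := by
    rintro c (hc | hc) d
    · exact mul_eq_zero_iff_star_mul_eq_zero_of_mem_cone proper salient hc d
    · exact mul_eq_zero_iff_star_mul_eq_zero_of_normal proper hc d
  rw [star_iff a ha, star_iff b hb, ← star_eq_zero, star_mul, star_star]
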